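/- Let X be a Polish space, Θ a closed subset of ℝ^p with Euclidean norm, {Pθ}_{θ∈Θ} a family of Borel probability measures on X, θ0 ∈ Θ, and P0 = P_{θ0}. Let D be a metric on the space P(X) of Borel probability measures such that, for every P ∈ P(X) and ε > 0, the ball { Q : D(Q, P) ≤ ε } is convex and closed with respect to the total variation distance. Define the gauge b0(δ) = sup { ‖θ − θ0‖ : θ ∈ Θ, D(Pθ, P_{θ0}) ≤ δ } and ε* = sup { δ > 0 : b0(δ) < ∞ }, and for a probability measure P define the OWL functional OF(P) = argmin_{θ∈Θ} I_ε(θ; P), where I_ε(θ; P) = min { KL(Q | Pθ) : Q ∈ P(X), D(Q, P) ≤ ε }. Suppose 0 < ε < ε*/2. Then for every δ ∈ (0, ε) and every Borel probability measure P with D(P, P0) ≤ δ, the Hausdorff distance between OF(P) and OF(P0) (as subsets of ℝ^p) satisfies d_H( OF(P), OF(P0) ) ≤ b0(2ε) < ∞. In particular, sup { d_H(OF(P), OF(P0)) : P ∈ P(X), D(P, P0) ≤ δ } ≤ b0(2ε) for every δ ∈ (0, ε), so the breakdown point of the OWL functional at P0 is at least ε. -/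

import Mathlib

open MeasureTheory ENNReal Filter Topology
open scoped Classical

/-- Total variation distance between measures: `tv(P, Q) = sup_A |P(A) − Q(A)|` over
measurable sets `A`. -/
noncomputable def tvMeas {X : Type*} [MeasurableSpace X] (P Q : Measure X) : ℝ :=
  ⨆ A : {s : Set X // MeasurableSet s}, |(P A).toReal - (Q A).toReal|

/-- Kullback–Leibler divergence `KL(Q|P) = ∫ log (dQ/dP) dQ` if `Q ≪ P` (and the integral
exists), and `∞` otherwise. -/
noncomputable def KLdiv {X : Type*} [MeasurableSpace X] (Q P : Measure X) : ℝ≥0∞ :=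
  if Q ≪ P ∧ Integrable (fun x => Real.log (Q.rnDeriv P x).toReal) Q
  then ENNReal.ofReal (∫ x, Real.log (Q.rnDeriv P x).toReal ∂Q) else ⊤

/-- OKL with respect to a real-valued discrepancy `D`:
`I_ε(θ; P) = inf { KL(Q|Pθ) : D(Q, P) ≤ ε }`. -/
noncomputable def OKLD {X : Type*} [MeasurableSpace X]
    (D : Measure X → Measure X → ℝ) (Pm Pθ : Measure X) (ε : ℝ) : ℝ≥0∞ :=
  ⨅ Q ∈ {Q : Measure X | IsProbabilityMeasure Q ∧ D Q Pm ≤ ε}, KLdiv Q Pθ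

/-- The OWL functional: the set of minimizers of `θ ↦ I_ε(θ; Pm)` over `Θ`. -/
def OWLset {X : Type*} [MeasurableSpace X] {p : ℕ}
    (D : Measure X → Measure X → ℝ) (Θ : Set (EuclideanSpace ℝ (Fin p)))
    (P : EuclideanSpace ℝ (Fin p) → Measure X) (ε : ℝ) (Pm : Measure X) :
    Set (EuclideanSpace ℝ (Fin p)) :=
  {θ | θ ∈ Θ ∧ ∀ θ' ∈ Θ, OKLD D Pm (P θ) ε ≤ OKLD D Pm (P θ') ε}

/-- The gauge `b₀(δ) = sup { ‖θ − θ0‖ : θ ∈ Θ, D(Pθ, P_{θ0}) ≤ δ }` as an extended real. -/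
noncomputable def gauge0 {X : Type*} [MeasurableSpace X] {p : ℕ}
    (D : Measure X → Measure X → ℝ) (Θ : Set (EuclideanSpace ℝ (Fin p)))
    (P : EuclideanSpace ℝ (Fin p) → Measure X) (θ0 : EuclideanSpace ℝ (Fin p))
    (δ : ℝ) : ℝ≥0∞ :=
  ⨆ θ ∈ {θ | θ ∈ Θ ∧ D (P θ) (P θ0) ≤ δ}, ENNReal.ofReal ‖θ - θ0‖

/-- The squared Hellinger integrand is dominated by the Kullback–Leibler integrand. -/
lemma sq_sqrt_sub_one_le_klFun {x : ℝ} (hx : 0 ≤ x) :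
    (√x - 1) ^ 2 ≤ InformationTheory.klFun x := by
  rcases hx.eq_or_lt with rfl | hx
  · simp [InformationTheory.klFun]
  have hs : 0 < √x := Real.sqrt_pos.2 hx
  have hsq : √x ^ 2 = x := Real.sq_sqrt hx.le
  have hlog : Real.log x = 2 * Real.log √x := by
    rw [Real.log_sqrt hx.le]; ring
  have hlow : 1 - (√x)⁻¹ ≤ Real.log √x := Real.one_sub_inv_le_log_of_pos hs
  have hmul : √x ^ 2 * (1 - (√x)⁻¹) ≤ √x ^ 2 * Real.log √x := by gcongr
  have hinv : √x ^ 2 * (1 - (√x)⁻¹) = √x ^ 2 - √x := by field_simp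
  rw [InformationTheory.klFun_apply, hlog]
  nlinarith

lemma abs_sub_one_le_klFun {x t : ℝ} (hx : 0 ≤ x) (ht : 0 < t) :
    |x - 1| ≤ (2 * t)⁻¹ * InformationTheory.klFun x + t * (x + 1) := by
  have hs : 0 ≤ √x := Real.sqrt_nonneg x
  have hsq : √x ^ 2 = x := Real.sq_sqrt hx
  have hfactor : |x - 1| = |√x - 1| * (√x + 1) := by
    rw [← abs_of_nonneg (by positivity : 0 ≤ √x + 1), ← abs_mul]
    congr 1
    linear_combination -hsq
  have hyoung : |√x - 1| * (√x + 1) ≤ (2 * t)⁻¹ * (√x - 1) ^ 2 + t / 2 * (√x + 1) ^ 2 := by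
    have hdiff : (2 * t)⁻¹ * (√x - 1) ^ 2 + t / 2 * (√x + 1) ^ 2 - |√x - 1| * (√x + 1)
        = (2 * t)⁻¹ * (|√x - 1| - t * (√x + 1)) ^ 2 := by
      rw [← sq_abs (√x - 1)]
      field_simp
      ring
    have : 0 ≤ (2 * t)⁻¹ * (|√x - 1| - t * (√x + 1)) ^ 2 := by positivity
    linarith
  have hkl : (2 * t)⁻¹ * (√x - 1) ^ 2 ≤ (2 * t)⁻¹ * InformationTheory.klFun x := by
    gcongr
    exact sq_sqrt_sub_one_le_klFun hx
  have hquad : t / 2 * (√x + 1) ^ 2 ≤ t * (x + 1) := by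
    nlinarith [mul_nonneg ht.le (sq_nonneg (√x - 1))]
  linarith

/-- A Pinsker-type inequality, with a non-optimal constant. -/
lemma tvMeas_le_of_KLdiv_le {X : Type*} [MeasurableSpace X] {Q P : Measure X}
    [IsProbabilityMeasure Q] [IsProbabilityMeasure P] {t : ℝ} (ht : 0 < t)
    (h : KLdiv Q P ≤ ENNReal.ofReal (t ^ 2)) : tvMeas Q P ≤ 3 * t := by
  unfold KLdiv at h
  split_ifs at h with hQP
  swap
  · exact absurd h (by simp)
  obtain ⟨hac, hint⟩ := hQP
  have hkl : ∫ x, InformationTheory.klFun (Q.rnDeriv P x).toReal ∂P ≤ t ^ 2 := by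
    rw [InformationTheory.integral_klFun_rnDeriv hac hint]
    have := (ENNReal.ofReal_le_ofReal_iff (by positivity)).1 h
    simpa [llr] using this
  have hklint : Integrable (fun x => InformationTheory.klFun (Q.rnDeriv P x).toReal) P :=
    (InformationTheory.integrable_klFun_rnDeriv_iff hac).2 hint
  have hf : Integrable (fun x => (Q.rnDeriv P x).toReal) P := Measure.integrable_toReal_rnDeriv
  have hsub : Integrable (fun x => (Q.rnDeriv P x).toReal - 1) P := hf.sub (integrable_const 1)
  have hone : Integrable (fun x => t * ((Q.rnDeriv P x).toReal + 1)) P :=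
    (hf.add (integrable_const 1)).const_mul t
  have hL1 : ∫ x, |(Q.rnDeriv P x).toReal - 1| ∂P ≤ 3 * t := by
    calc ∫ x, |(Q.rnDeriv P x).toReal - 1| ∂P
        ≤ ∫ x, ((2 * t)⁻¹ * InformationTheory.klFun (Q.rnDeriv P x).toReal
            + t * ((Q.rnDeriv P x).toReal + 1)) ∂P :=
          integral_mono hsub.abs ((hklint.const_mul _).add hone)
            fun x => abs_sub_one_le_klFun ENNReal.toReal_nonneg ht
      _ = (2 * t)⁻¹ * ∫ x, InformationTheory.klFun (Q.rnDeriv P x).toReal ∂P + t * 2 := by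
          rw [integral_add (hklint.const_mul _) hone, integral_const_mul, integral_const_mul,
            integral_add hf (integrable_const 1), Measure.integral_toReal_rnDeriv hac]
          norm_num
      _ ≤ (2 * t)⁻¹ * t ^ 2 + t * 2 := by gcongr
      _ ≤ 3 * t := by
          have : (2 * t)⁻¹ * t ^ 2 = t / 2 := by field_simp
          linarith
  have : Nonempty {s : Set X // MeasurableSet s} := ⟨⟨∅, MeasurableSet.empty⟩⟩
  refine ciSup_le fun A => ?_
  have hA : (Q A).toReal - (P A).toReal = ∫ x in (A : Set X), ((Q.rnDeriv P x).toReal - 1) ∂P := by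
    rw [integral_sub hf.integrableOn (integrable_const 1).integrableOn,
      Measure.setIntegral_toReal_rnDeriv hac]
    simp [measureReal_def]
  rw [hA]
  exact (abs_integral_le_integral_abs.trans
    (setIntegral_le_integral hsub.abs (ae_of_all _ fun _ => abs_nonneg _))).trans hL1

lemma tvMeas_nonneg {X : Type*} [MeasurableSpace X] (Q P : Measure X) : 0 ≤ tvMeas Q P :=
  Real.iSup_nonneg fun _ => abs_nonneg _

lemma KLdiv_self {X : Type*} [MeasurableSpace X] (P : Measure X) [IsProbabilityMeasure P] :
    KLdiv P P = 0 := by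
  have h : llr P P =ᵐ[P] 0 := llr_self P
  have hint : Integrable (llr P P) P := (integrable_congr h).2 (integrable_zero _ _ _)
  have h0 : ∫ x, llr P P x ∂P = 0 := by simp [integral_congr_ae h]
  rw [KLdiv, if_pos ⟨Measure.AbsolutelyContinuous.rfl, hint⟩]
  exact ENNReal.ofReal_eq_zero.2 h0.le

lemma OKLD_eq_zero_of_le {X : Type*} [MeasurableSpace X] {D : Measure X → Measure X → ℝ}
    {Pm Pθ : Measure X} [hPθ : IsProbabilityMeasure Pθ] {ε : ℝ} (h : D Pθ Pm ≤ ε) :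
    OKLD D Pm Pθ ε = 0 :=
  le_antisymm ((iInf₂_le Pθ ⟨hPθ, h⟩).trans (KLdiv_self Pθ).le) zero_le

/-- If the discrepancy ball is closed in total variation, a vanishing OKL puts the model
measure inside the ball. -/
lemma le_of_OKLD_eq_zero {X : Type*} [MeasurableSpace X] {D : Measure X → Measure X → ℝ}
    {Pm Pθ : Measure X} [IsProbabilityMeasure Pθ] {ε : ℝ}
    (hclosed : ∀ Qs : ℕ → Measure X, (∀ n, IsProbabilityMeasure (Qs n)) →
      (∀ n, D (Qs n) Pm ≤ ε) → Tendsto (fun n => tvMeas (Qs n) Pθ) atTop (𝓝 0) → D Pθ Pm ≤ ε)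
    (h : OKLD D Pm Pθ ε = 0) : D Pθ Pm ≤ ε := by
  have hex : ∀ n : ℕ, ∃ Q : Measure X, (IsProbabilityMeasure Q ∧ D Q Pm ≤ ε) ∧
      KLdiv Q Pθ < ENNReal.ofReal ((1 / ((n : ℝ) + 1)) ^ 2) := by
    intro n
    have hlt : OKLD D Pm Pθ ε < ENNReal.ofReal ((1 / ((n : ℝ) + 1)) ^ 2) := by
      rw [h, ENNReal.ofReal_pos]
      positivity
    simpa [OKLD, iInf_lt_iff] using hlt
  choose Qs hQs hkl using hex
  refine hclosed Qs (fun n => (hQs n).1) (fun n => (hQs n).2) ?_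
  have hlim : Tendsto (fun n : ℕ => 3 * (1 / ((n : ℝ) + 1))) atTop (𝓝 0) := by
    simpa using tendsto_one_div_add_atTop_nhds_zero_nat.const_mul (3 : ℝ)
  refine squeeze_zero (fun n => tvMeas_nonneg _ _) (fun n => ?_) hlim
  have := (hQs n).1
  exact tvMeas_le_of_KLdiv_le Nat.one_div_pos_of_nat (hkl n).le

lemma gauge0_mono {X : Type*} [MeasurableSpace X] {p : ℕ} (D : Measure X → Measure X → ℝ)
    (Θ : Set (EuclideanSpace ℝ (Fin p))) (P : EuclideanSpace ℝ (Fin p) → Measure X)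
    (θ0 : EuclideanSpace ℝ (Fin p)) : Monotone (gauge0 D Θ P θ0) :=
  fun _ _ h => biSup_mono fun _ hθ => ⟨hθ.1, hθ.2.trans h⟩

/-- Lower bound on the breakdown point of the OWL functional: if `ε < ε*/2`, then for all
`δ ∈ (0, ε)` and every probability measure `P'` with `D(P', P0) ≤ δ`, the Hausdorff distance
between `OF(P')` and `OF(P0)` is at most `b₀(2ε) < ∞`. -/
theorem stmt19 {X : Type*} [MeasurableSpace X] [TopologicalSpace X] [PolishSpace X]
    [BorelSpace X] (p : ℕ)
    (Θ : Set (EuclideanSpace ℝ (Fin p))) (hΘ : IsClosed Θ)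
    (θ0 : EuclideanSpace ℝ (Fin p)) (hθ0 : θ0 ∈ Θ)
    (P : EuclideanSpace ℝ (Fin p) → Measure X)
    (hP : ∀ θ ∈ Θ, IsProbabilityMeasure (P θ))
    (D : Measure X → Measure X → ℝ)
    (hDnonneg : ∀ Pm Q : Measure X, IsProbabilityMeasure Pm → IsProbabilityMeasure Q →
      0 ≤ D Pm Q)
    (hDeq : ∀ Pm Q : Measure X, IsProbabilityMeasure Pm → IsProbabilityMeasure Q →
      (D Pm Q = 0 ↔ Pm = Q))
    (hDsymm : ∀ Pm Q : Measure X, IsProbabilityMeasure Pm → IsProbabilityMeasure Q →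
      D Pm Q = D Q Pm)
    (hDtri : ∀ Pm Q R : Measure X, IsProbabilityMeasure Pm → IsProbabilityMeasure Q →
      IsProbabilityMeasure R → D Pm Q ≤ D Pm R + D R Q)
    (hballconv : ∀ Pm : Measure X, IsProbabilityMeasure Pm → ∀ ε' : ℝ, 0 < ε' →
      ∀ Q1 Q2 : Measure X, IsProbabilityMeasure Q1 → IsProbabilityMeasure Q2 →
      D Q1 Pm ≤ ε' → D Q2 Pm ≤ ε' → ∀ t : ℝ, 0 ≤ t → t ≤ 1 →
      D (ENNReal.ofReal (1 - t) • Q1 + ENNReal.ofReal t • Q2) Pm ≤ ε')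
    (hballclosed : ∀ Pm : Measure X, IsProbabilityMeasure Pm → ∀ ε' : ℝ, 0 < ε' →
      ∀ Qs : ℕ → Measure X, (∀ n, IsProbabilityMeasure (Qs n)) →
      (∀ n, D (Qs n) Pm ≤ ε') → ∀ Q : Measure X, IsProbabilityMeasure Q →
      Tendsto (fun n => tvMeas (Qs n) Q) atTop (𝓝 0) → D Q Pm ≤ ε')
    (ε : ℝ) (hε : 0 < ε)
    (hεstar : ∃ δ : ℝ, 2 * ε < δ ∧ gauge0 D Θ P θ0 δ ≠ ⊤) :
    ∀ δ : ℝ, 0 < δ → δ < ε → ∀ P' : Measure X, IsProbabilityMeasure P' →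
      D P' (P θ0) ≤ δ →
      EMetric.hausdorffEdist (OWLset D Θ P ε P') (OWLset D Θ P ε (P θ0)) ≤
          gauge0 D Θ P θ0 (2 * ε) ∧
        gauge0 D Θ P θ0 (2 * ε) ≠ ⊤ := by
  intro δ hδ hδε P' hP' hDP'
  have hP0 := hP θ0 hθ0
  have hmem : ∀ Pm : Measure X, IsProbabilityMeasure Pm → D Pm (P θ0) ≤ ε →
      θ0 ∈ OWLset D Θ P ε Pm := by
    intro Pm hPm hD
    refine ⟨hθ0, fun θ' _ => ?_⟩
    rw [OKLD_eq_zero_of_le ((hDsymm _ _ hP0 hPm).trans_le hD)]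
    exact zero_le
  have hbound : ∀ Pm : Measure X, IsProbabilityMeasure Pm → D Pm (P θ0) ≤ ε →
      ∀ θ ∈ OWLset D Θ P ε Pm, edist θ θ0 ≤ gauge0 D Θ P θ0 (2 * ε) := by
    intro Pm hPm hD θ hθ
    have hPθ := hP θ hθ.1
    have hzero : OKLD D Pm (P θ) ε = 0 := le_antisymm ((hθ.2 θ0 hθ0).trans
      (OKLD_eq_zero_of_le ((hDsymm _ _ hP0 hPm).trans_le hD)).le) zero_le
    have hDθ : D (P θ) Pm ≤ ε := le_of_OKLD_eq_zero
      (fun Qs hQs hQD htv => hballclosed Pm hPm ε hε Qs hQs hQD (P θ) hPθ htv) hzero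
    have hD0 : D (P θ) (P θ0) ≤ 2 * ε := by
      linarith [hDtri (P θ) (P θ0) Pm hPθ hP0 hPm]
    rw [edist_dist, dist_eq_norm]
    exact le_iSup₂_of_le θ ⟨hθ.1, hD0⟩ le_rfl
  have hself : D (P θ0) (P θ0) ≤ ε := ((hDeq _ _ hP0 hP0).2 rfl).trans_le hε.le
  refine ⟨Metric.hausdorffEDist_le_of_mem_edist
    (fun θ hθ => ⟨θ0, hmem _ hP0 hself, hbound P' hP' (hDP'.trans hδε.le) θ hθ⟩)
    (fun θ hθ => ⟨θ0, hmem P' hP' (hDP'.trans hδε.le), hbound _ hP0 hself θ hθ⟩), ?_⟩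
  obtain ⟨η, hη, htop⟩ := hεstar
  exact ne_top_of_le_ne_top htop (gauge0_mono D Θ P θ0 hη.le)
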